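/- Let K be an algebraically closed field of characteristic 0, c ≥ 4 an integer, and A_c the explicit c×(2c+2) matrix of linear forms in x, y, t defined in the context. Then the space of linear syzygies {v ∈ (S₁)^{2c+2} : A_c·v = 0 in (S₂)^c} has dimension exactly c + 2, where S₁ and S₂ denote the spaces of homogeneous polynomials of degree 1 and 2 in K[x,y,t]. (This is Lemma 18: for the minimal-rank 1-type uniform bundle E_c of Example 9, h⁰(E_c(1)) = c + 2.) -/

import Mathlib

open Matrix MvPolynomial

/-- Column index (1-based) of the `x` entry of row `j` of the matrix `A_c`:
`(p₁,p₂,p_j) = (1,4,2j+1)`. -/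
def pcol (j : ℕ) : ℕ := if j = 1 then 1 else if j = 2 then 4 else 2 * j + 1

/-- Column index (1-based) of the `y` entry of row `j` of the matrix `A_c`:
`(q₁,q₂,q_j) = (2,5,2j+2)`. -/
def qcol (j : ℕ) : ℕ := pcol j + 1

/-- The entry of the matrix `A_c` in (1-based) row `i` and column `j`, evaluated at
`(x, y, t) = (p 0, p 1, p 2)`. -/
def AcEnt {R : Type*} [CommRing R] (p : Fin 3 → R) (i j : ℕ) : R :=
  if i ≤ 2 then
    (if j = pcol i then p 0 else 0) + (if j = qcol i then p 1 else 0) +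
      (if j = qcol i + 1 then p 2 else 0)
  else
    (if j = 2 * i + 1 then p 0 else 0) + (if j = 2 * i + 2 then p 1 else 0) +
      (if j = pcol (i - 2) then p 2 else 0) + (if j = qcol (i - 1) then p 2 else 0)

/-- The explicit `c × (2c+2)` matrix `A_c` of Example 9, evaluated at
`(x, y, t) = (p 0, p 1, p 2)`. -/
def Ac {R : Type*} [CommRing R] (c : ℕ) (p : Fin 3 → R) :
    Matrix (Fin c) (Fin (2 * c + 2)) R :=
  fun i j => AcEnt p ((i : ℕ) + 1) ((j : ℕ) + 1)

/-- The matrix `A_c` as a matrix of linear forms over `S = K[x,y,t]`,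
with `(x, y, t) = (X 0, X 1, X 2)`. -/
noncomputable def AcPoly (K : Type*) [Field K] (c : ℕ) :
    Matrix (Fin c) (Fin (2 * c + 2)) (MvPolynomial (Fin 3) K) :=
  Ac c (fun k => MvPolynomial.X k)

namespace Aux11

variable {K : Type*} [Field K]

/-- Unit coordinate points. -/
def pt (K : Type*) [Field K] (k : Fin 3) : Fin 3 → K := fun l => if l = k then 1 else 0

/-- The coefficient functional of a linear form. -/
noncomputable def cf (k : Fin 3) (f : MvPolynomial (Fin 3) K) : K := eval (pt K k) f

lemma lin_eq (f : MvPolynomial (Fin 3) K) (hf : f ∈ homogeneousSubmodule (Fin 3) K 1) :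
    f = C (cf 0 f) * X 0 + C (cf 1 f) * X 1 + C (cf 2 f) * X 2 := by
  rw [homogeneousSubmodule_one_eq_span_X] at hf
  induction hf using Submodule.span_induction with
  | mem x hx =>
    obtain ⟨i, rfl⟩ := hx
    fin_cases i <;> simp [cf, pt]
  | zero => simp [cf]
  | add x y _ _ hx hy =>
    have h : ∀ k, cf k (x + y) = cf k x + cf k y := fun k => by simp [cf]
    rw [h, h, h]
    conv_lhs => rw [hx, hy]
    simp only [map_add]
    ring
  | smul a x _ hx =>
    have h : ∀ k, cf k (a • x) = a * cf k x := fun k => by simp [cf, smul_eval]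
    rw [h, h, h]
    conv_lhs => rw [hx]
    simp only [map_mul, smul_eq_C_mul]
    ring

lemma koszul (P Q R : MvPolynomial (Fin 3) K)
    (hP : P ∈ homogeneousSubmodule (Fin 3) K 1) (hQ : Q ∈ homogeneousSubmodule (Fin 3) K 1)
    (hR : R ∈ homogeneousSubmodule (Fin 3) K 1) (h : X 0 * P + X 1 * Q + X 2 * R = 0) :
    cf 0 P = 0 ∧ cf 1 Q = 0 ∧ cf 2 R = 0 ∧ cf 0 Q = - cf 1 P ∧ cf 0 R = - cf 2 P ∧
      cf 1 R = - cf 2 Q := by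
  rw [lin_eq P hP, lin_eq Q hQ, lin_eq R hR] at h
  have e : ∀ p : Fin 3 → K, _ := fun p => congrArg (eval p) h
  simp only [map_add, map_mul, eval_X, eval_C, map_zero] at e
  have h0 := e ![1, 0, 0]
  have h1 := e ![0, 1, 0]
  have h2 := e ![0, 0, 1]
  have h01 := e ![1, 1, 0]
  have h02 := e ![1, 0, 1]
  have h12 := e ![0, 1, 1]
  simp at h0 h1 h2 h01 h02 h12
  simp only [h0, h1, h2] at h01 h02 h12
  refine ⟨h0, h1, h2, ?_, ?_, ?_⟩
  · linear_combination h01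
  · linear_combination h02
  · linear_combination h12

/-- Extension of a vector to all 1-based indices. -/
def ext1 {M : Type*} [Zero M] {n : ℕ} (v : Fin n → M) (m : ℕ) : M :=
  if h : 1 ≤ m ∧ m ≤ n then v ⟨m - 1, by omega⟩ else 0

lemma ext1_succ {M : Type*} [Zero M] {n : ℕ} (v : Fin n → M) (j : Fin n) :
    ext1 v ((j : ℕ) + 1) = v j := by
  have := j.2
  unfold ext1
  rw [dif_pos (by omega)]
  rfl

lemma sum_ext1 {M : Type*} [CommRing M] {n : ℕ} (v : Fin n → M) (m : ℕ) (a : M) :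
    ∑ j : Fin n, (if (j : ℕ) + 1 = m then a else 0) * v j = a * ext1 v m := by
  unfold ext1
  split_ifs with h
  · rw [Finset.sum_eq_single ⟨m - 1, by omega⟩]
    · rw [if_pos]
      simp only
      omega
    · intro b _ hb
      rw [if_neg, zero_mul]
      intro hh
      apply hb
      ext
      simp only
      omega
    · simp
  · rw [mul_zero]
    apply Finset.sum_eq_zero
    intro j _
    have := j.2
    rw [if_neg (by omega), zero_mul]

/-- Third entry of the row relation. -/
def third {M : Type*} [Add M] (w : ℕ → M) (i : ℕ) : M :=
  if i ≤ 2 then w (qcol i + 1) else w (pcol (i - 2)) + w (qcol (i - 1))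

lemma row_eq {c : ℕ} (v : Fin (2 * c + 2) → MvPolynomial (Fin 3) K) (i : Fin c) :
    (AcPoly K c).mulVec v i = X 0 * ext1 v (pcol (i + 1)) + X 1 * ext1 v (qcol (i + 1)) +
      X 2 * third (ext1 v) (i + 1) := by
  simp only [Matrix.mulVec, dotProduct, AcPoly, Ac, AcEnt, third]
  by_cases h : (i : ℕ) + 1 ≤ 2
  · simp only [if_pos h, add_mul, Finset.sum_add_distrib, sum_ext1]
  · simp only [if_neg h, add_mul, Finset.sum_add_distrib, sum_ext1]
    have hp : pcol ((i : ℕ) + 1) = 2 * ((i : ℕ) + 1) + 1 := by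
      unfold pcol
      rw [if_neg (by omega), if_neg (by omega)]
    have hq : qcol ((i : ℕ) + 1) = 2 * ((i : ℕ) + 1) + 2 := by
      unfold qcol
      rw [hp]
    rw [hp, hq]
    ring

/-- The `x` column entry. -/
noncomputable def PP (s : ℕ → K) (i : ℕ) : MvPolynomial (Fin 3) K :=
  C (s (i + 1)) * X 1 + C (s i) * X 2

/-- The `y` column entry. -/
noncomputable def QQ (s : ℕ → K) (i : ℕ) : MvPolynomial (Fin 3) K :=
  - (C (s (i + 1)) * X 0) - C (s (i - 1)) * X 2

/-- The third entry. -/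
noncomputable def RR (s : ℕ → K) (i : ℕ) : MvPolynomial (Fin 3) K :=
  - (C (s i) * X 0) + C (s (i - 1)) * X 1

/-- The solution attached to a sequence. -/
noncomputable def colv (s : ℕ → K) (n : ℕ) : MvPolynomial (Fin 3) K :=
  if n = 1 then PP s 1 else if n = 2 then QQ s 1 else if n = 3 then RR s 1 else
  if n = 4 then PP s 2 else if n = 5 then QQ s 2 else if n = 6 then RR s 2 else
  if n % 2 = 1 then PP s ((n - 1) / 2) else QQ s ((n - 2) / 2)

lemma col_cases (n : ℕ) (hn : 1 ≤ n) : n = 3 ∨ n = 6 ∨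
    (∃ i, 1 ≤ i ∧ (i ≤ 2 ∨ 2 * i + 1 ≤ n) ∧ (n = pcol i ∨ n = qcol i)) := by
  by_cases h1 : n = 1
  · exact Or.inr (Or.inr ⟨1, by omega, by omega, by simp [h1, pcol]⟩)
  by_cases h2 : n = 2
  · exact Or.inr (Or.inr ⟨1, by omega, by omega, by simp [h2, pcol, qcol]⟩)
  by_cases h4 : n = 4
  · exact Or.inr (Or.inr ⟨2, by omega, by omega, by simp [h4, pcol]⟩)
  by_cases h5 : n = 5
  · exact Or.inr (Or.inr ⟨2, by omega, by omega, by simp [h5, pcol, qcol]⟩)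
  by_cases h3 : n = 3
  · exact Or.inl h3
  by_cases h6 : n = 6
  · exact Or.inr (Or.inl h6)
  refine Or.inr (Or.inr ⟨(n - 1) / 2, by omega, by omega, ?_⟩)
  unfold qcol pcol
  rw [if_neg (by omega), if_neg (by omega)]
  omega

lemma colv_p (s : ℕ → K) (i : ℕ) (hi : 1 ≤ i) : colv s (pcol i) = PP s i := by
  by_cases h1 : i = 1
  · subst h1; simp [colv, pcol]
  by_cases h2 : i = 2
  · subst h2; simp [colv, pcol]
  unfold colv pcol
  rw [if_neg h1, if_neg h2]
  iterate 6 rw [if_neg (by omega)]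
  rw [if_pos (by omega)]
  congr 1
  omega

lemma colv_q (s : ℕ → K) (i : ℕ) (hi : 1 ≤ i) : colv s (qcol i) = QQ s i := by
  by_cases h1 : i = 1
  · subst h1; simp [colv, pcol, qcol]
  by_cases h2 : i = 2
  · subst h2; simp [colv, pcol, qcol]
  unfold colv qcol pcol
  rw [if_neg h1, if_neg h2]
  iterate 6 rw [if_neg (by omega)]
  rw [if_neg (by omega)]
  congr 1
  omega

lemma colv_third (s : ℕ → K) (i : ℕ) (hi : 1 ≤ i) : third (colv s) i = RR s i := by
  unfold third
  split_ifs with h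
  · interval_cases i <;> simp [colv, qcol, pcol]
  · rw [colv_p _ _ (by omega), colv_q _ _ (by omega)]
    obtain ⟨k, rfl⟩ : ∃ k, i = k + 3 := ⟨i - 3, by omega⟩
    simp only [PP, QQ, RR, show k + 3 - 2 = k + 1 by omega, show k + 3 - 1 = k + 2 by omega,
      show k + 2 - 1 = k + 1 by omega]
    ring

lemma pcol_le {c i : ℕ} (hc : 4 ≤ c) (hi : 1 ≤ i) (hic : i ≤ c) :
    1 ≤ pcol i ∧ qcol i ≤ 2 * c + 2 ∧ pcol i ≤ 2 * c + 2 ∧ 1 ≤ qcol i := by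
  unfold qcol pcol
  split_ifs <;> omega

lemma colv_hom (s : ℕ → K) (n : ℕ) : colv s n ∈ homogeneousSubmodule (Fin 3) K 1 := by
  have hX : ∀ (a : K) (k : Fin 3), C a * X k ∈ homogeneousSubmodule (Fin 3) K 1 := by
    intro a k
    rw [← smul_eq_C_mul]
    exact Submodule.smul_mem _ _ ((mem_homogeneousSubmodule _ _).2 (isHomogeneous_X K k))
  have hP : ∀ i, PP s i ∈ homogeneousSubmodule (Fin 3) K 1 := fun i =>
    Submodule.add_mem _ (hX _ _) (hX _ _)
  have hQ : ∀ i, QQ s i ∈ homogeneousSubmodule (Fin 3) K 1 := fun i =>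
    Submodule.sub_mem _ (Submodule.neg_mem _ (hX _ _)) (hX _ _)
  have hR : ∀ i, RR s i ∈ homogeneousSubmodule (Fin 3) K 1 := fun i =>
    Submodule.add_mem _ (Submodule.neg_mem _ (hX _ _)) (hX _ _)
  unfold colv
  split_ifs
  exacts [hP _, hQ _, hR _, hP _, hQ _, hR _, hP _, hQ _]

lemma colv_add (s s' : ℕ → K) (n : ℕ) : colv (s + s') n = colv s n + colv s' n := by
  unfold colv
  split_ifs <;> simp only [PP, QQ, RR, Pi.add_apply, map_add] <;> ring

lemma colv_smul (a : K) (s : ℕ → K) (n : ℕ) : colv (a • s) n = a • colv s n := by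
  unfold colv
  split_ifs <;> simp only [PP, QQ, RR, Pi.smul_apply, smul_eq_mul, map_mul, smul_eq_C_mul] <;> ring

/-- Extension by zero, zero-based. -/
def ext0 {n : ℕ} (s : Fin n → K) (m : ℕ) : K := if h : m < n then s ⟨m, h⟩ else 0

/-- The parametrization of the syzygies. -/
noncomputable def phi (K : Type*) [Field K] (c : ℕ) :
    (Fin (c + 2) → K) →ₗ[K] (Fin (2 * c + 2) → MvPolynomial (Fin 3) K) where
  toFun s := fun j => colv (ext0 s) (j + 1)
  map_add' s s' := by
    ext1 j
    rw [Pi.add_apply, ← colv_add]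
    congr 1
    ext m
    simp only [ext0, Pi.add_apply]
    split_ifs <;> simp
  map_smul' a s := by
    ext1 j
    rw [Pi.smul_apply, RingHom.id_apply, ← colv_smul]
    congr 1
    ext m
    simp only [ext0, Pi.smul_apply]
    split_ifs <;> simp

lemma ext1_phi {c : ℕ} (s : Fin (c + 2) → K) (n : ℕ) (h1 : 1 ≤ n) (h2 : n ≤ 2 * c + 2) :
    ext1 (phi K c s) n = colv (ext0 s) n := by
  unfold ext1
  rw [dif_pos ⟨h1, h2⟩]
  simp only [phi, LinearMap.coe_mk, AddHom.coe_mk]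
  congr 1
  omega

lemma third_congr {M : Type*} [Add M] {c : ℕ} (hc : 4 ≤ c) (w w' : ℕ → M)
    (h : ∀ n, 1 ≤ n → n ≤ 2 * c + 2 → w n = w' n) (i : ℕ) (hi : 1 ≤ i) (hic : i ≤ c) :
    third w i = third w' i := by
  unfold third
  split_ifs with h2
  · apply h
    · omega
    · unfold qcol pcol
      split_ifs <;> omega
  · have a := pcol_le hc (show 1 ≤ i - 2 by omega) (by omega)
    have b := pcol_le hc (show 1 ≤ i - 1 by omega) (by omega)
    rw [h _ a.1 a.2.2.1, h _ b.2.2.2 b.2.1]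

lemma cf_PP1 (s : ℕ → K) (i : ℕ) : cf 1 (PP s i) = s (i + 1) := by simp [cf, PP, pt]
lemma cf_PP2 (s : ℕ → K) (i : ℕ) : cf 2 (PP s i) = s i := by simp [cf, PP, pt]
lemma cf_QQ2 (s : ℕ → K) (i : ℕ) : cf 2 (QQ s i) = - s (i - 1) := by simp [cf, QQ, pt]

lemma phi_inj {c : ℕ} (hc : 4 ≤ c) : Function.Injective (phi K c) := by
  intro s s' h
  have hcol : ∀ n, 1 ≤ n → n ≤ 2 * c + 2 → colv (ext0 s) n = colv (ext0 s') n := by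
    intro n h1 h2
    rw [← ext1_phi s n h1 h2, h, ext1_phi s' n h1 h2]
  have hP : ∀ i, 1 ≤ i → i ≤ c → PP (ext0 s) i = PP (ext0 s') i := by
    intro i h1 h2
    have a := pcol_le hc h1 h2
    rw [← colv_p _ _ h1, ← colv_p _ _ h1, hcol _ a.1 a.2.2.1]
  have hQ : QQ (ext0 s) 1 = QQ (ext0 s') 1 := by
    have a := pcol_le hc le_rfl (show 1 ≤ c by omega)
    rw [← colv_q _ _ le_rfl, ← colv_q _ _ le_rfl, hcol _ a.2.2.2 a.2.1]
  have key : ∀ m, m < c + 2 → ext0 s m = ext0 s' m := by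
    intro m hm
    match m with
    | 0 =>
      have := congrArg (cf 2) hQ
      rw [cf_QQ2, cf_QQ2] at this
      exact neg_injective this
    | 1 =>
      have := congrArg (cf 2) (hP 1 le_rfl (by omega))
      rwa [cf_PP2, cf_PP2] at this
    | (k + 2) =>
      have := congrArg (cf 1) (hP (k + 1) (by omega) (by omega))
      rwa [cf_PP1, cf_PP1] at this
  ext m
  have := key m m.2
  simpa [ext0] using this

lemma phi_mem {c : ℕ} (hc : 4 ≤ c) (s : Fin (c + 2) → K) :
    (AcPoly K c).mulVec (phi K c s) = 0 := by
  ext1 i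
  have hi := i.2
  have a := pcol_le hc (show 1 ≤ (i : ℕ) + 1 by omega) (by omega)
  rw [row_eq, ext1_phi _ _ a.1 a.2.2.1, ext1_phi _ _ a.2.2.2 a.2.1,
    third_congr hc _ _ (ext1_phi s) _ (by omega) (by omega), colv_p _ _ (by omega),
    colv_q _ _ (by omega), colv_third _ _ (by omega)]
  simp only [PP, QQ, RR, Pi.zero_apply]
  ring

lemma cf_add (k : Fin 3) (f g : MvPolynomial (Fin 3) K) : cf k (f + g) = cf k f + cf k g := by
  simp [cf]

lemma phi_surj {c : ℕ} (hc : 4 ≤ c) (v : Fin (2 * c + 2) → MvPolynomial (Fin 3) K)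
    (hv : ∀ j, v j ∈ homogeneousSubmodule (Fin 3) K 1) (h : (AcPoly K c).mulVec v = 0) :
    ∃ s, phi K c s = v := by
  set w := ext1 v with hw
  have hwl : ∀ n, w n ∈ homogeneousSubmodule (Fin 3) K 1 := by
    intro n
    simp only [hw, ext1]
    split_ifs
    · exact hv _
    · exact Submodule.zero_mem _
  have hthird : ∀ i, third w i ∈ homogeneousSubmodule (Fin 3) K 1 := by
    intro i
    unfold third
    split_ifs
    · exact hwl _
    · exact Submodule.add_mem _ (hwl _) (hwl _)
  have rel : ∀ i, 1 ≤ i → i ≤ c → _ := fun i h1 h2 =>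
    koszul (w (pcol i)) (w (qcol i)) (third w i) (hwl _) (hwl _) (hthird _) (by
      have := congrFun h ⟨i - 1, by omega⟩
      rw [row_eq] at this
      simp only [Nat.sub_add_cancel h1] at this
      exact this)
  let s : ℕ → K := fun m => match m with
    | 0 => - cf 2 (w (qcol 1))
    | 1 => cf 2 (w (pcol 1))
    | (k + 2) => cf 1 (w (pcol (k + 1)))
  have third3 : ∀ i k, 3 ≤ i →
      cf k (third w i) = cf k (w (pcol (i - 2))) + cf k (w (qcol (i - 1))) := by
    intro i k hi
    unfold third
    rw [if_neg (by omega), cf_add]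
  -- coefficients of `t`
  have hP2' : ∀ i, 2 ≤ i → i ≤ c → cf 2 (w (pcol i)) = cf 1 (w (pcol (i - 1))) ∧
      cf 2 (w (qcol i)) = - s (i - 1) := by
    have big : ∀ i, 3 ≤ i → i ≤ c → cf 2 (w (pcol i)) = cf 1 (w (pcol (i - 1))) ∧
        cf 2 (w (qcol i)) = - s (i - 1) := by
      intro i hi hic
      obtain ⟨k, rfl⟩ : ∃ k, i = k + 3 := ⟨i - 3, by omega⟩
      have r := rel (k + 3) (by omega) hic
      have r1 := rel (k + 2) (by omega) (by omega)
      have r2 := rel (k + 1) (by omega) (by omega)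
      rw [third3 _ _ hi, third3 _ _ hi, third3 _ _ hi] at r
      simp only [show k + 3 - 2 = k + 1 by omega, show k + 3 - 1 = k + 2 by omega] at r ⊢
      obtain ⟨-, -, -, -, r5, r6⟩ := r
      obtain ⟨-, p2, -, p4, -, -⟩ := r1
      obtain ⟨q1, -, -, -, -, -⟩ := r2
      refine ⟨?_, ?_⟩
      · linear_combination r5 - q1 - p4
      · change _ = - cf 1 (w (pcol (k + 1)))
        linear_combination r6 - p2
    intro i hi hic
    by_cases h2 : i = 2
    · subst h2
      have r3 := (rel 3 (by omega) (by omega)).2.2.1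
      have r4 := (rel 4 (by omega) (by omega)).2.2.1
      have b3 := (big 3 (by omega) (by omega)).2
      rw [third3 _ _ (by omega)] at r3 r4
      simp only [show 4 - 2 = 2 from rfl, show 4 - 1 = 3 from rfl, show 3 - 2 = 1 from rfl,
        show 3 - 1 = 2 from rfl, show 2 - 1 = 1 from rfl] at r3 r4 b3 ⊢
      change _ = - cf 1 (w (pcol 1)) at b3
      change _ ∧ _ = - cf 2 (w (pcol 1))
      exact ⟨by linear_combination r4 - b3, by linear_combination r3⟩
    · exact big i (by omega) hic
  have hP2 : ∀ i, 1 ≤ i → i ≤ c → cf 2 (w (pcol i)) = s i := by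
    intro i h1 h2
    by_cases hi : i = 1
    · subst hi; rfl
    · rw [(hP2' i (by omega) h2).1]
      obtain ⟨k, rfl⟩ : ∃ k, i = k + 2 := ⟨i - 2, by omega⟩
      rfl
  have hQ2 : ∀ i, 1 ≤ i → i ≤ c → cf 2 (w (qcol i)) = - s (i - 1) := by
    intro i h1 h2
    by_cases hi : i = 1
    · subst hi; exact (neg_neg _).symm
    · exact (hP2' i (by omega) h2).2
  have hP1 : ∀ i, 1 ≤ i → cf 1 (w (pcol i)) = s (i + 1) := by
    intro i h1
    obtain ⟨k, rfl⟩ : ∃ k, i = k + 1 := ⟨i - 1, by omega⟩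
    rfl
  have hPP : ∀ i, 1 ≤ i → i ≤ c → w (pcol i) = PP s i := by
    intro i h1 h2
    rw [lin_eq _ (hwl (pcol i)), (rel i h1 h2).1, hP1 i h1, hP2 i h1 h2]
    simp [PP]
  have hQQ : ∀ i, 1 ≤ i → i ≤ c → w (qcol i) = QQ s i := by
    intro i h1 h2
    rw [lin_eq _ (hwl (qcol i)), (rel i h1 h2).2.1, (rel i h1 h2).2.2.2.1, hP1 i h1, hQ2 i h1 h2]
    simp [QQ]
    ring
  have hRR : ∀ i, 1 ≤ i → i ≤ c → third w i = RR s i := by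
    intro i h1 h2
    obtain ⟨-, -, r3, -, r5, r6⟩ := rel i h1 h2
    rw [lin_eq _ (hthird i), r3, r5, r6, hP2 i h1 h2, hQ2 i h1 h2]
    simp [RR]
  refine ⟨fun m => s m, ?_⟩
  have hext : ∀ m, m < c + 2 → ext0 (fun m : Fin (c + 2) => s m) m = s m := by
    intro m hm
    simp [ext0, hm]
  ext1 j
  have hj := j.2
  change colv _ _ = _
  rw [← ext1_succ v j]
  change _ = w _
  rcases col_cases ((j : ℕ) + 1) (by omega) with h3 | h6 | ⟨i, hi1, hi2, hp | hq⟩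
  · rw [h3]
    have := hRR 1 le_rfl (by omega)
    have e : third w 1 = w 3 := by simp [third, qcol, pcol]
    rw [← e, this]
    simp [colv, RR, hext]
  · rw [h6]
    have := hRR 2 (by omega) (by omega)
    have e : third w 2 = w 6 := by simp [third, qcol, pcol]
    rw [← e, this]
    simp only [colv, RR]
    rw [hext 2 (by omega), hext (2 - 1) (by omega)]
    simp
  · have hic : i ≤ c := by omega
    rw [hp, hPP i hi1 hic, colv_p _ _ hi1]
    simp only [PP]
    rw [hext _ (by omega), hext _ (by omega)]
  · have hic : i ≤ c := by omega
    rw [hq, hQQ i hi1 hic, colv_q _ _ hi1]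
    simp only [QQ]
    rw [hext _ (by omega), hext _ (by omega)]

end Aux11

/-- **Lemma 18.** For the minimal-rank 1-type uniform Steiner bundle `E_c` of Example 9
(`c ≥ 4`), the space of linear syzygies
`{v ∈ (S₁)^{2c+2} : A_c·v = 0 in (S₂)^c}` has dimension exactly `c + 2`,
i.e. `h⁰(E_c(1)) = c + 2`. -/
theorem stmt11 {K : Type*} [Field K] [IsAlgClosed K] [CharZero K]
    (c : ℕ) (hc : 4 ≤ c) :
    Module.finrank K
      ↥((Submodule.pi Set.univ
          (fun _ : Fin (2 * c + 2) => homogeneousSubmodule (Fin 3) K 1)) ⊓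
        (LinearMap.ker (AcPoly K c).mulVecLin).restrictScalars K) = c + 2 := by
  have hrange : ((Submodule.pi Set.univ
          (fun _ : Fin (2 * c + 2) => homogeneousSubmodule (Fin 3) K 1)) ⊓
        (LinearMap.ker (AcPoly K c).mulVecLin).restrictScalars K) =
      LinearMap.range (Aux11.phi K c) := by
    apply le_antisymm
    · rintro v ⟨h1, h2⟩
      obtain ⟨s, hs⟩ := Aux11.phi_surj hc v (fun j => h1 j (Set.mem_univ j)) h2
      exact ⟨s, hs⟩
    · rintro _ ⟨s, rfl⟩
      exact ⟨fun j _ => Aux11.colv_hom _ _, Aux11.phi_mem hc s⟩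
  rw [hrange, LinearMap.finrank_range_of_inj (Aux11.phi_inj hc)]
  simp
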